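/- arXiv:2511.09703 — 5 statements merged into one kernel-verified Lean document; each statement's English description precedes it below -/
import Mathlib

section
/- Let M be an unambiguous monoid morphism and suppose Q = Q₁ ∪ Q₂ is a partition of Q such that [Q₂]^T M(w) [Q₁] = 0 for all w ∈ Σ*; for each w let M₁(w) and M₂(w) denote the Q₁×Q₁ and Q₂×Q₂ submatrices of M(w), respectively (so M₁ and M₂ are themselves unambiguous monoid morphisms). Then rank_ℝ(M) = rank_ℝ(M₁) + rank_ℝ(M₂) and rank_un(M) = rank_un(M₁) + rank_un(M₂). -/
open Matrix

/-- Indicator (0/1) column vector of a set of states: `ind S q = 1` iff `q ∈ S`. -/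
noncomputable def ind {Q : Type*} (S : Set Q) : Q → ℝ := S.indicator 1

namespace UFA

variable {Q σ : Type*}

/-- `y` is a column of the monoid morphism `M`, i.e. `y = M(w)[q]` for some word `w`, state `q`. -/
def IsCol (M : List σ → Matrix Q Q ℝ) (y : Q → ℝ) : Prop :=
  ∃ w : List σ, ∃ q : Q, y = fun p => M w p q

/-- `x` is a row of `M`, i.e. `xᵀ = [q]ᵀ M(w)` for some word `w` and state `q`. -/
def IsRow (M : List σ → Matrix Q Q ℝ) (x : Q → ℝ) : Prop :=
  ∃ w : List σ, ∃ q : Q, x = fun p => M w q p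

/-- A maximal column: a column `y` such that no column `y' ≠ y` satisfies `y' ≥ y`. -/
def IsMaxCol (M : List σ → Matrix Q Q ℝ) (y : Q → ℝ) : Prop :=
  IsCol M y ∧ ∀ y', IsCol M y' → y ≤ y' → y' = y

/-- A maximal row: a row `x` such that no row `x' ≠ x` satisfies `x' ≥ x`. -/
def IsMaxRow (M : List σ → Matrix Q Q ℝ) (x : Q → ℝ) : Prop :=
  IsRow M x ∧ ∀ x', IsRow M x' → x ≤ x' → x' = x

/-- Unambiguous rank of a zero-one matrix: the least `r` such that `A = C * R` with `C, R`
zero-one matrices having `r` columns resp. `r` rows. -/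
noncomputable def rankUnMat (A : Matrix Q Q ℝ) : ℕ :=
  sInf {r : ℕ | ∃ C : Matrix Q (Fin r) ℝ, ∃ R : Matrix (Fin r) Q ℝ,
    (∀ i j, C i j = 0 ∨ C i j = 1) ∧ (∀ i j, R i j = 0 ∨ R i j = 1) ∧ A = C * R}

/-- Minimum unambiguous rank of the matrix monoid generated by `M`. -/
noncomputable def rankUn (M : List σ → Matrix Q Q ℝ) : ℕ :=
  sInf (Set.range fun w => rankUnMat (M w))

/-- Minimum real rank of the matrix monoid generated by `M`. -/
noncomputable def rankReal [Fintype Q] (M : List σ → Matrix Q Q ℝ) : ℕ :=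
  sInf (Set.range fun w => (M w).rank)

/-- `Mer M q`: the set of states that appear together with `q` in some column. -/
def Mer (M : List σ → Matrix Q Q ℝ) (q : Q) : Set Q :=
  {q' | ∃ S : Set Q, q ∈ S ∧ q' ∈ S ∧ IsCol M (ind S)}

end UFA

theorem exists_pow_isIdempotentElem {G : Type*} [Monoid G] {a : G} {S : Set G} (hS : S.Finite)
    (ha : ∀ n : ℕ, a ^ n ∈ S) : ∃ n : ℕ, IsIdempotentElem (a ^ (n + 1)) := by
  have hninj : ¬ Function.Injective fun n : ℕ => (⟨a ^ n, ha n⟩ : S) := by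
    have := hS.to_subtype
    exact not_injective_infinite_finite _
  obtain ⟨i, p, hp, hip⟩ : ∃ i p : ℕ, 0 < p ∧ a ^ (i + p) = a ^ i := by
    rw [Function.not_injective_iff] at hninj
    obtain ⟨i, j, hij, hne⟩ := hninj
    have hij' : a ^ i = a ^ j := congrArg Subtype.val hij
    rcases lt_or_gt_of_ne hne with h | h
    · exact ⟨i, j - i, by omega, by rw [Nat.add_sub_cancel' h.le, hij']⟩
    · exact ⟨j, i - j, by omega, by rw [Nat.add_sub_cancel' h.le, hij']⟩
  have hperiod : ∀ k m : ℕ, a ^ (i + m + k * p) = a ^ (i + m) := by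
    intro k m
    induction k with
    | zero => simp
    | succ k ih =>
      rw [show i + m + (k + 1) * p = (i + p) + (m + k * p) by ring, pow_add, hip, ← pow_add,
        ← add_assoc, ih]
  obtain ⟨q, rfl⟩ : ∃ q, p = q + 1 := ⟨p - 1, by omega⟩
  refine ⟨(i + 1) * (q + 1) - 1, ?_⟩
  have hpos : (i + 1) * (q + 1) - 1 + 1 = (i + 1) * (q + 1) :=
    Nat.sub_add_cancel (Nat.mul_pos i.succ_pos q.succ_pos)
  have h := hperiod (i + 1) (i * q + q + 1)
  rw [show i + (i * q + q + 1) = (i + 1) * (q + 1) by ring, pow_add] at h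
  rwa [hpos]

namespace Matrix

/-- All entries of the matrix are `0` or `1`. -/
def IsZeroOne {m n : Type*} (A : Matrix m n ℝ) : Prop := ∀ i j, A i j = 0 ∨ A i j = 1

theorem finite_setOf_isZeroOne (m n : Type*) [Finite m] [Finite n] :
    {A : Matrix m n ℝ | A.IsZeroOne}.Finite := by
  have h : (Set.univ.pi fun _ : m => Set.univ.pi fun _ : n => ({0, 1} : Set ℝ)).Finite :=
    Set.Finite.pi fun _ => Set.Finite.pi fun _ => Set.toFinite _
  refine h.subset fun A hA => ?_
  simpa [Set.mem_pi] using show ∀ i j, A i j = 0 ∨ A i j = 1 from hA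

namespace IsZeroOne

variable {n : Type*} {e : Matrix n n ℝ}

theorem nonneg (he : e.IsZeroOne) (i j : n) : 0 ≤ e i j := by
  rcases he i j with h | h <;> simp [h]

theorem le_one (he : e.IsZeroOne) (i j : n) : e i j ≤ 1 := by
  rcases he i j with h | h <;> simp [h]

variable [Fintype n]

theorem eq_one_trans (he : e.IsZeroOne) (hi : IsIdempotentElem e) {p r q : n}
    (h₁ : e p r = 1) (h₂ : e r q = 1) : e p q = 1 := by
  have hsum : e p q = ∑ s, e p s * e s q := by rw [← mul_apply, hi.eq]
  have hle : e p r * e r q ≤ ∑ s, e p s * e s q :=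
    Finset.single_le_sum (f := fun s => e p s * e s q)
      (fun s _ => mul_nonneg (he.nonneg p s) (he.nonneg s q)) (Finset.mem_univ r)
  rw [← hsum, h₁, h₂, one_mul] at hle
  exact le_antisymm (he.le_one p q) hle

theorem eq_of_eq_one (he : e.IsZeroOne) (hi : IsIdempotentElem e) {p r s q : n}
    (hr₁ : e p r = 1) (hr₂ : e r q = 1) (hs₁ : e p s = 1) (hs₂ : e s q = 1) : r = s := by
  classical
  by_contra hne
  have hsum : e p q = ∑ s, e p s * e s q := by rw [← mul_apply, hi.eq]
  have hle : ∑ t ∈ {r, s}, e p t * e t q ≤ ∑ t, e p t * e t q :=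
    Finset.sum_le_sum_of_subset_of_nonneg (Finset.subset_univ _)
      fun t _ _ => mul_nonneg (he.nonneg p t) (he.nonneg t q)
  rw [Finset.sum_pair hne, ← hsum, hr₁, hr₂, hs₁, hs₂] at hle
  linarith [he.le_one p q]

theorem exists_between (he : e.IsZeroOne) (hi : IsIdempotentElem e) {p q : n}
    (h : e p q = 1) : ∃ r, e p r = 1 ∧ e r q = 1 := by
  by_contra! hno
  have hsum : e p q = ∑ s, e p s * e s q := by rw [← mul_apply, hi.eq]
  rw [h, Finset.sum_eq_zero] at hsum
  · exact one_ne_zero hsum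
  · intro s _
    rcases he p s with h₁ | h₁
    · simp [h₁]
    · simp [(he s q).resolve_right (hno s h₁)]

theorem exists_fixed_between (he : e.IsZeroOne) (hi : IsIdempotentElem e) {p q : n}
    (h : e p q = 1) : ∃ r, e r r = 1 ∧ e p r = 1 ∧ e r q = 1 := by
  classical
  induction hk : (Finset.univ.filter fun r => e p r = 1 ∧ e r q = 1).card
    using Nat.strong_induction_on generalizing p with
  | _ k ih =>
    obtain ⟨r, hpr, hrq⟩ := he.exists_between hi h
    by_cases hrr : e r r = 1
    · exact ⟨r, hrr, hpr, hrq⟩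
    · obtain ⟨s, hss, hrs, hsq⟩ := ih _ (by
        rw [← hk]
        refine Finset.card_lt_card (Finset.ssubset_iff_of_subset ?_ |>.2 ⟨r, ?_, ?_⟩)
        · intro s hs
          simp only [Finset.mem_filter, Finset.mem_univ, true_and] at hs ⊢
          exact ⟨he.eq_one_trans hi hpr hs.1, hs.2⟩
        · simp [hpr, hrq]
        · simp [hrr]) hrq rfl
      exact ⟨s, hss, he.eq_one_trans hi hpr hrs, hsq⟩

/-- A zero-one idempotent factors through its fixed points. -/
theorem eq_submatrix_mul_submatrix (he : e.IsZeroOne) (hi : IsIdempotentElem e) :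
    e = e.submatrix id (Subtype.val : {r // e r r = 1} → n) *
      e.submatrix (Subtype.val : {r // e r r = 1} → n) id := by
  classical
  ext p q
  have hsum : e p q = ∑ s, e p s * e s q := by rw [← mul_apply, hi.eq]
  rw [mul_apply, hsum]
  simp only [submatrix_apply, id_eq]
  rw [← Finset.sum_subtype (Finset.univ.filter fun r => e r r = 1) (by simp)
    fun r => e p r * e r q]
  refine (Finset.sum_subset (Finset.subset_univ _) fun r _ hr => ?_).symm
  rcases he p r with h₁ | h₁
  · rw [h₁, zero_mul]
  rcases he r q with h₂ | h₂
  · rw [h₂, mul_zero]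
  obtain ⟨s, hss, hps, hsq⟩ := he.exists_fixed_between hi (he.eq_one_trans hi h₁ h₂)
  rw [he.eq_of_eq_one hi h₁ h₂ hps hsq] at hr
  simp [hss] at hr

theorem submatrix_mul_submatrix_eq_one [DecidableEq n] (he : e.IsZeroOne) (hi : IsIdempotentElem e) :
    e.submatrix (Subtype.val : {r // e r r = 1} → n) id *
      e.submatrix id (Subtype.val : {r // e r r = 1} → n) = 1 := by
  rw [← submatrix_mul _ _ _ _ _ Function.bijective_id, hi.eq]
  ext p q
  rw [submatrix_apply, one_apply]
  split_ifs with hpq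
  · rw [hpq, q.2]
  · refine (he p q).resolve_right fun h => hpq (Subtype.ext ?_)
    exact he.eq_of_eq_one hi p.2 h h q.2

theorem rank_eq_card (he : e.IsZeroOne) (hi : IsIdempotentElem e) :
    e.rank = Nat.card {r // e r r = 1} := by
  classical
  rw [Nat.card_eq_fintype_card]
  apply le_antisymm
  · conv_lhs => rw [he.eq_submatrix_mul_submatrix hi]
    exact (rank_mul_le_left _ _).trans (rank_le_card_width _)
  · set C := e.submatrix id (Subtype.val : {r // e r r = 1} → n)
    set R := e.submatrix (Subtype.val : {r // e r r = 1} → n) id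
    have hRC : R * C = 1 := he.submatrix_mul_submatrix_eq_one hi
    have hCR : C * R = e := (he.eq_submatrix_mul_submatrix hi).symm
    have h : R * (C * R) * C = 1 := by
      rw [← Matrix.mul_assoc, hRC, Matrix.one_mul, hRC]
    rw [hCR] at h
    rw [← rank_one (R := ℝ), ← h]
    exact (rank_mul_le_left _ _).trans (rank_mul_le_right _ _)

theorem rankUnMat_le_rank (he : e.IsZeroOne) (hi : IsIdempotentElem e) :
    UFA.rankUnMat e ≤ e.rank := by
  rw [he.rank_eq_card hi]
  let f := (Finite.equivFin {r // e r r = 1}).symm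
  refine Nat.sInf_le ⟨e.submatrix id (fun i => (f i : n)), e.submatrix (fun i => (f i : n)) id,
    fun i j => he _ _, fun i j => he _ _, ?_⟩
  conv_lhs => rw [he.eq_submatrix_mul_submatrix hi]
  ext p q
  simp only [mul_apply, submatrix_apply, id_eq]
  exact (Equiv.sum_comp f fun r => e p r * e r q).symm

end IsZeroOne

theorem IsZeroOne.rank_le_rankUnMat {n : Type*} [Fintype n] {A : Matrix n n ℝ}
    (hA : A.IsZeroOne) : A.rank ≤ UFA.rankUnMat A := by
  classical
  have hne : {r : ℕ | ∃ C : Matrix n (Fin r) ℝ, ∃ R : Matrix (Fin r) n ℝ,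
      (∀ i j, C i j = 0 ∨ C i j = 1) ∧ (∀ i j, R i j = 0 ∨ R i j = 1) ∧ A = C * R}.Nonempty := by
    let f := Fintype.equivFin n
    refine ⟨Fintype.card n, A.submatrix id f.symm, (1 : Matrix n n ℝ).submatrix f.symm id,
      fun _ _ => hA _ _, fun i j => ?_, ?_⟩
    · rw [submatrix_apply, one_apply]
      split_ifs <;> simp
    · rw [submatrix_mul_equiv, Matrix.mul_one, submatrix_id_id]
  obtain ⟨C, R, -, -, h⟩ := Nat.sInf_mem hne
  conv_lhs => rw [h]
  exact (rank_mul_le_left _ _).trans ((rank_le_card_width C).trans_eq (Fintype.card_fin _))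

end Matrix

namespace UFA

/-- An unambiguous monoid morphism from words to real matrices. -/
structure IsUnambiguous {Q σ : Type*} [Fintype Q] [DecidableEq Q]
    (M : List σ → Matrix Q Q ℝ) : Prop where
  map_nil : M [] = 1
  map_append : ∀ u v, M (u ++ v) = M u * M v
  isZeroOne : ∀ w, (M w).IsZeroOne

section

variable {Q σ : Type*} [Fintype Q] {M : List σ → Matrix Q Q ℝ}

theorem rankReal_le (M : List σ → Matrix Q Q ℝ) (w : List σ) : rankReal M ≤ (M w).rank :=
  Nat.sInf_le ⟨w, rfl⟩

theorem exists_rank_eq_rankReal (M : List σ → Matrix Q Q ℝ) : ∃ w, (M w).rank = rankReal M :=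
  Nat.sInf_mem (Set.range_nonempty fun w => (M w).rank)

namespace IsUnambiguous

variable [DecidableEq Q]

theorem map_flatten_replicate (hM : IsUnambiguous M) (w : List σ) (n : ℕ) :
    M (List.replicate n w).flatten = M w ^ n := by
  induction n with
  | zero => simpa using hM.map_nil
  | succ n ih => rw [List.replicate_succ, List.flatten_cons, hM.map_append, ih, pow_succ']

theorem exists_append_isIdempotentElem (hM : IsUnambiguous M) (w : List σ) :
    ∃ v, IsIdempotentElem (M (w ++ v)) := by
  obtain ⟨n, hn⟩ := exists_pow_isIdempotentElem (Matrix.finite_setOf_isZeroOne Q Q)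
    (a := M w) fun n => by
      rw [← hM.map_flatten_replicate]
      exact hM.isZeroOne _
  refine ⟨(List.replicate n w).flatten, ?_⟩
  rwa [hM.map_append, hM.map_flatten_replicate, ← pow_succ']

theorem rank_append_le_left (hM : IsUnambiguous M) (u v : List σ) :
    (M (u ++ v)).rank ≤ (M u).rank := by
  rw [hM.map_append]
  exact Matrix.rank_mul_le_left _ _

theorem rank_append_le_right (hM : IsUnambiguous M) (u v : List σ) :
    (M (u ++ v)).rank ≤ (M v).rank := by
  rw [hM.map_append]
  exact Matrix.rank_mul_le_right _ _

/-- The minimum is attained at an idempotent, whose two ranks coincide. -/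
theorem rankUn_eq_rankReal (hM : IsUnambiguous M) : rankUn M = rankReal M := by
  apply le_antisymm
  · obtain ⟨w, hw⟩ := exists_rank_eq_rankReal M
    obtain ⟨v, hv⟩ := hM.exists_append_isIdempotentElem w
    calc rankUn M ≤ rankUnMat (M (w ++ v)) := Nat.sInf_le ⟨w ++ v, rfl⟩
      _ ≤ (M (w ++ v)).rank := (hM.isZeroOne _).rankUnMat_le_rank hv
      _ ≤ (M w).rank := hM.rank_append_le_left w v
      _ = rankReal M := hw
  · obtain ⟨w, hw⟩ := Nat.sInf_mem (Set.range_nonempty fun w => rankUnMat (M w))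
    calc rankReal M ≤ (M w).rank := rankReal_le M w
      _ ≤ rankUnMat (M w) := (hM.isZeroOne w).rank_le_rankUnMat
      _ = rankUn M := hw

end IsUnambiguous

end

section BlockTriangular

variable {Q₁ Q₂ σ : Type*} [Fintype Q₁] [DecidableEq Q₁] [Fintype Q₂] [DecidableEq Q₂]
  {M : List σ → Matrix (Q₁ ⊕ Q₂) (Q₁ ⊕ Q₂) ℝ}

namespace IsUnambiguous

theorem toBlocks₁₁ (hM : IsUnambiguous M) (hB : ∀ w, (M w).toBlocks₂₁ = 0) :
    IsUnambiguous fun w => (M w).toBlocks₁₁ where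
  map_nil := by rw [hM.map_nil, ← Matrix.fromBlocks_one, Matrix.toBlocks_fromBlocks₁₁]
  map_append u v := by
    ext p q
    have h : ∀ r, M v (Sum.inr r) (Sum.inl q) = 0 := fun r => congrFun₂ (hB v) r q
    simp [hM.map_append, Matrix.toBlocks₁₁, Matrix.mul_apply, h]
  isZeroOne w p q := hM.isZeroOne w _ _

theorem toBlocks₂₂ (hM : IsUnambiguous M) (hB : ∀ w, (M w).toBlocks₂₁ = 0) :
    IsUnambiguous fun w => (M w).toBlocks₂₂ where
  map_nil := by rw [hM.map_nil, ← Matrix.fromBlocks_one, Matrix.toBlocks_fromBlocks₂₂]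
  map_append u v := by
    ext p q
    have h : ∀ r, M u (Sum.inr p) (Sum.inl r) = 0 := fun r => congrFun₂ (hB u) p r
    simp [hM.map_append, Matrix.toBlocks₂₂, Matrix.mul_apply, h]
  isZeroOne w p q := hM.isZeroOne w _ _

theorem rank_eq_add_of_isIdempotentElem (hM : IsUnambiguous M)
    (hB : ∀ w, (M w).toBlocks₂₁ = 0) {w : List σ} (hw : IsIdempotentElem (M w)) :
    (M w).rank = (M w).toBlocks₁₁.rank + (M w).toBlocks₂₂.rank := by
  have h : M (w ++ w) = M w := by rw [hM.map_append, hw.eq]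
  have h₁ : IsIdempotentElem (M w).toBlocks₁₁ := by
    rw [IsIdempotentElem, ← (hM.toBlocks₁₁ hB).map_append, h]
  have h₂ : IsIdempotentElem (M w).toBlocks₂₂ := by
    rw [IsIdempotentElem, ← (hM.toBlocks₂₂ hB).map_append, h]
  rw [(hM.isZeroOne w).rank_eq_card hw, ((hM.toBlocks₁₁ hB).isZeroOne w).rank_eq_card h₁,
    ((hM.toBlocks₂₂ hB).isZeroOne w).rank_eq_card h₂, ← Nat.card_sum]
  exact Nat.card_congr Equiv.subtypeSum

theorem rankReal_eq_add (hM : IsUnambiguous M) (hB : ∀ w, (M w).toBlocks₂₁ = 0) :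
    rankReal M = rankReal (fun w => (M w).toBlocks₁₁) + rankReal fun w => (M w).toBlocks₂₂ := by
  apply le_antisymm
  · obtain ⟨u, hu⟩ := exists_rank_eq_rankReal fun w => (M w).toBlocks₁₁
    obtain ⟨v, hv⟩ := exists_rank_eq_rankReal fun w => (M w).toBlocks₂₂
    obtain ⟨x, hx⟩ := hM.exists_append_isIdempotentElem (u ++ v)
    have h₁ : (M (u ++ v ++ x)).toBlocks₁₁.rank ≤ (M u).toBlocks₁₁.rank :=
      ((hM.toBlocks₁₁ hB).rank_append_le_left (u ++ v) x).trans
        ((hM.toBlocks₁₁ hB).rank_append_le_left u v)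
    have h₂ : (M (u ++ v ++ x)).toBlocks₂₂.rank ≤ (M v).toBlocks₂₂.rank :=
      ((hM.toBlocks₂₂ hB).rank_append_le_left (u ++ v) x).trans
        ((hM.toBlocks₂₂ hB).rank_append_le_right u v)
    rw [← hu, ← hv]
    exact ((rankReal_le M _).trans_eq (hM.rank_eq_add_of_isIdempotentElem hB hx)).trans
      (add_le_add h₁ h₂)
  · obtain ⟨w, hw⟩ := exists_rank_eq_rankReal M
    obtain ⟨v, hv⟩ := hM.exists_append_isIdempotentElem w
    have h₁ := rankReal_le (fun w => (M w).toBlocks₁₁) (w ++ v)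
    have h₂ := rankReal_le (fun w => (M w).toBlocks₂₂) (w ++ v)
    calc _ ≤ (M (w ++ v)).toBlocks₁₁.rank + (M (w ++ v)).toBlocks₂₂.rank := add_le_add h₁ h₂
      _ = (M (w ++ v)).rank := (hM.rank_eq_add_of_isIdempotentElem hB hv).symm
      _ ≤ (M w).rank := hM.rank_append_le_left w v
      _ = rankReal M := hw

end IsUnambiguous

end BlockTriangular

end UFA

theorem rank_block_triangular {Q₁ Q₂ σ : Type*} [Fintype Q₁] [DecidableEq Q₁] [Fintype Q₂] [DecidableEq Q₂]
    [Nonempty σ]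
    (M : List σ → Matrix (Q₁ ⊕ Q₂) (Q₁ ⊕ Q₂) ℝ)
    (hM0 : M [] = 1) (hMm : ∀ u v, M (u ++ v) = M u * M v)
    (hUn : ∀ w i j, M w i j = 0 ∨ M w i j = 1)
    (hBlock : ∀ (w : List σ) (p : Q₂) (q : Q₁), M w (Sum.inr p) (Sum.inl q) = 0) :
    UFA.rankReal M
      = UFA.rankReal (fun w => Matrix.of fun p q => M w (Sum.inl p) (Sum.inl q))
      + UFA.rankReal (fun w => Matrix.of fun p q => M w (Sum.inr p) (Sum.inr q)) ∧
    UFA.rankUn M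
      = UFA.rankUn (fun w => Matrix.of fun p q => M w (Sum.inl p) (Sum.inl q))
      + UFA.rankUn (fun w => Matrix.of fun p q => M w (Sum.inr p) (Sum.inr q)) := by
  have hM : UFA.IsUnambiguous M := ⟨hM0, hMm, hUn⟩
  have hB : ∀ w, (M w).toBlocks₂₁ = 0 := fun w => Matrix.ext (hBlock w)
  have h := hM.rankReal_eq_add hB
  refine ⟨h, ?_⟩
  rw [← hM.rankUn_eq_rankReal, ← (hM.toBlocks₁₁ hB).rankUn_eq_rankReal,
    ← (hM.toBlocks₂₂ hB).rankUn_eq_rankReal] at h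
  exact h
end

section
/- Let A be a Q×Q matrix with nonnegative integer entries such that [Q]^T A ≥ [Q]^T (every column sum is at least 1) and A [Q] ≥ [Q] (every row sum is at least 1). Then A is a permutation matrix, or sup_{i ≥ 0} [Q]^T A^i [Q] = ∞ (the total sum of entries of the powers A^i is unbounded). -/
open Matrix

/-- If all column sums of `A` are positive, so are those of every power of `A`. -/
theorem Matrix.one_le_col_sum_pow {Q : Type*} [Fintype Q] [DecidableEq Q] {A : Matrix Q Q ℕ}
    (hA : ∀ q, 1 ≤ ∑ p, A p q) (n : ℕ) (q : Q) : 1 ≤ ∑ p, (A ^ n) p q := by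
  induction n generalizing q with
  | zero => simp [Matrix.one_apply]
  | succ n ih =>
    calc 1 ≤ ∑ r, A r q := hA q
      _ ≤ ∑ r, (∑ p, (A ^ n) p r) * A r q :=
        Finset.sum_le_sum fun r _ => Nat.le_mul_of_pos_left _ (ih r)
      _ = ∑ p, (A ^ (n + 1)) p q := by
        simp_rw [pow_succ, Matrix.mul_apply, Finset.sum_mul]
        exact Finset.sum_comm

/-- The sum of all entries of `B * A` in terms of column sums of `B` and row sums of `A`. -/
theorem Matrix.sum_entries_mul {Q : Type*} [Fintype Q] (B A : Matrix Q Q ℕ) :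
    ∑ p, ∑ q, (B * A) p q = ∑ r, (∑ p, B p r) * ∑ q, A r q := by
  simp_rw [Matrix.mul_apply, Finset.sum_mul_sum]
  calc _ = ∑ p, ∑ r, ∑ q, B p r * A r q := Finset.sum_congr rfl fun _ _ => Finset.sum_comm
    _ = _ := Finset.sum_comm

/-- If all row and column sums are positive and some row sum is not one, then the sum of all
entries of `A ^ n` is at least `n`. -/
theorem Matrix.le_sum_entries_pow {Q : Type*} [Fintype Q] [DecidableEq Q] {A : Matrix Q Q ℕ}
    (hcol : ∀ q, 1 ≤ ∑ p, A p q) (hrow : ∀ p, 1 ≤ ∑ q, A p q) {r : Q} (hr : ∑ q, A r q ≠ 1)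
    (n : ℕ) : n ≤ ∑ p, ∑ q, (A ^ n) p q := by
  induction n with
  | zero => exact Nat.zero_le _
  | succ n ih =>
    refine Nat.succ_le_of_lt (ih.trans_lt ?_)
    rw [pow_succ, Matrix.sum_entries_mul]
    refine Finset.sum_comm.trans_lt (Finset.sum_lt_sum
      (fun p _ => Nat.le_mul_of_pos_right _ (hrow p)) ⟨r, Finset.mem_univ r, ?_⟩)
    have h1 := Matrix.one_le_col_sum_pow hcol n r
    have h2 : 1 < ∑ q, A r q := lt_of_le_of_ne (hrow r) hr.symm
    exact lt_mul_of_one_lt_right h1 h2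

/-- A natural matrix with unit row sums and positive column sums is a permutation matrix. -/
theorem Matrix.exists_perm_of_row_sum_eq_one {Q : Type*} [Fintype Q] [DecidableEq Q]
    {A : Matrix Q Q ℕ} (hcol : ∀ q, 1 ≤ ∑ p, A p q) (hrow : ∀ p, ∑ q, A p q = 1) :
    ∃ π : Equiv.Perm Q, ∀ i j, A i j = if π i = j then 1 else 0 := by
  have key : ∀ i, ∃ k, ∀ j, A i j = if k = j then 1 else 0 := by
    intro i
    obtain ⟨k, -, hk⟩ := Finset.exists_ne_zero_of_sum_ne_zero (by rw [hrow i]; exact one_ne_zero)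
    refine ⟨k, fun j => ?_⟩
    have hsum := Finset.add_sum_erase Finset.univ (A i) (Finset.mem_univ k)
    rw [hrow i] at hsum
    split_ifs with h
    · subst h; omega
    · have hj := Finset.single_le_sum (f := A i) (fun _ _ => Nat.zero_le _)
        (Finset.mem_erase.2 ⟨Ne.symm h, Finset.mem_univ j⟩)
      omega
  choose f hf using key
  have hsurj : Function.Surjective f := by
    intro j
    obtain ⟨i, -, hi⟩ := Finset.exists_ne_zero_of_sum_ne_zero (Nat.one_le_iff_ne_zero.1 (hcol j))
    refine ⟨i, ?_⟩
    by_contra h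
    exact hi (by rw [hf, if_neg h])
  exact ⟨Equiv.ofBijective f (Finite.surjective_iff_bijective.1 hsurj), hf⟩

theorem perm_or_unbounded {Q : Type*} [Fintype Q] [DecidableEq Q] [Nonempty Q]
    (A : Matrix Q Q ℕ)
    (hcolsum : ∀ q : Q, 1 ≤ ∑ p, A p q)
    (hrowsum : ∀ p : Q, 1 ≤ ∑ q, A p q) :
    (∃ π : Equiv.Perm Q, ∀ i j, A i j = if π i = j then 1 else 0) ∨
    (∀ N : ℕ, ∃ i : ℕ, N ≤ ∑ p, ∑ q, (A ^ i) p q) := by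
  by_cases h : ∀ p, ∑ q, A p q = 1
  · exact Or.inl (Matrix.exists_perm_of_row_sum_eq_one hcolsum h)
  · obtain ⟨r, hr⟩ := not_forall.1 h
    exact Or.inr fun N => ⟨N, Matrix.le_sum_entries_pow hcolsum hrowsum hr N⟩
end

section
/- V ⊆ span(MCol), i.e., the real span of the vectors M(w)β for w ∈ Σ* is contained in the real span of the set of maximal columns. -/
open Matrix

namespace UFA

variable {Q σ : Type*}

/-- A finitely valued function on words that is bounded by its average over one-letter extensions
attains its maximum at a word such that it is constant on all extensions of this word. -/
lemma exists_max_of_le_average [Fintype σ] (f : List σ → ℝ) (hf : (Set.range f).Finite)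
    (havg : ∀ w, (Fintype.card σ : ℝ) * f w ≤ ∑ a, f (w ++ [a])) :
    ∃ w, ∀ v, (∀ u, f u ≤ f (w ++ v)) ∧ f (w ++ v) = f w := by
  obtain ⟨_, ⟨w, rfl⟩, hw⟩ := hf.exists_maximal (Set.range_nonempty f)
  have hmax : ∀ u, f u ≤ f w := fun u => by
    by_contra! h
    exact h.not_ge (hw ⟨u, rfl⟩ h.le)
  have hext : ∀ v w, (∀ u, f u ≤ f w) → f (w ++ v) = f w := by
    intro v
    induction v with
    | nil => simp
    | cons a v ih =>
      intro w hw
      have hsum : ∑ b, (f w - f (w ++ [b])) = 0 := by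
        refine le_antisymm ?_ (Finset.sum_nonneg fun b _ => sub_nonneg.2 (hw _))
        simpa using havg w
      have ha := (Finset.sum_eq_zero_iff_of_nonneg fun b _ => sub_nonneg.2 (hw _)).1 hsum a
        (Finset.mem_univ a)
      have ha' : f (w ++ [a]) = f w := by linarith
      have := ih (w ++ [a]) (by simpa [ha'] using hw)
      simpa [ha'] using this
  exact ⟨w, fun v => by simpa [hext v w hmax] using hmax⟩

lemma finite_range_of_zero_one [Finite Q] (M : List σ → Matrix Q Q ℝ)
    (hUn : ∀ w i j, M w i j = 0 ∨ M w i j = 1) : (Set.range M).Finite := by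
  refine (Set.Finite.pi' (t := fun _ : Q => {r : Q → ℝ | ∀ j, r j ∈ ({0, 1} : Set ℝ)})
    fun _ => Set.Finite.pi' fun _ => Set.toFinite _).subset ?_
  rintro _ ⟨w, rfl⟩ i j
  simpa using hUn w i j

variable [Fintype Q]

/-- The `α`-weight of the column `M(w)[q]`. -/
def colWeight (M : List σ → Matrix Q Q ℝ) (α : Q → ℝ) (w : List σ) (q : Q) : ℝ :=
  (α ᵥ* M w) q

section Weight

variable {M : List σ → Matrix Q Q ℝ} {α : Q → ℝ}

lemma colWeight_append (hMm : ∀ u v, M (u ++ v) = M u * M v) (u v : List σ) (p : Q) :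
    colWeight M α (u ++ v) p = ∑ q, colWeight M α u q * M v q p := by
  simp only [colWeight, hMm, ← vecMul_vecMul]
  rfl

lemma colWeight_nonneg (hUn : ∀ w i j, M w i j = 0 ∨ M w i j = 1) (hα : ∀ q, 0 < α q)
    (w : List σ) (q : Q) : 0 ≤ colWeight M α w q :=
  Finset.sum_nonneg fun p _ => mul_nonneg (hα p).le (by rcases hUn w p q with h | h <;> simp [h])

lemma colWeight_le_append (hMm : ∀ u v, M (u ++ v) = M u * M v)
    (hUn : ∀ w i j, M w i j = 0 ∨ M w i j = 1) (hα : ∀ q, 0 < α q)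
    {u v : List σ} {q p : Q} (h : M v q p = 1) :
    colWeight M α u q ≤ colWeight M α (u ++ v) p := by
  rw [colWeight_append hMm]
  refine le_trans (by simp [h]) (Finset.single_le_sum (f := fun q => colWeight M α u q * M v q p)
    (fun r _ => mul_nonneg (colWeight_nonneg hUn hα u r) ?_) (Finset.mem_univ q))
  rcases hUn v r p with h | h <;> simp [h]

lemma exists_entry_eq_one_of_colWeight_ne_zero (hUn : ∀ w i j, M w i j = 0 ∨ M w i j = 1)
    {w : List σ} {q : Q} (h : colWeight M α w q ≠ 0) : ∃ p, M w p q = 1 := by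
  obtain ⟨p, -, hp⟩ := Finset.exists_ne_zero_of_sum_ne_zero h
  exact ⟨p, (hUn w p q).resolve_left (right_ne_zero_of_mul hp)⟩

lemma entry_eq_zero_of_colWeight_eq_zero (hUn : ∀ w i j, M w i j = 0 ∨ M w i j = 1)
    (hα : ∀ q, 0 < α q) {w : List σ} {q : Q} (h : colWeight M α w q = 0) (p : Q) :
    M w p q = 0 := by
  have hp := (Finset.sum_eq_zero_iff_of_nonneg fun r _ => mul_nonneg (hα r).le
    (by rcases hUn w r q with h | h <;> simp [h])).1 h p (Finset.mem_univ p)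
  exact (mul_eq_zero.1 hp).resolve_left (hα p).ne'

lemma isMaxCol_of_colWeight_max (hα : ∀ q, 0 < α q) {w : List σ} {q : Q}
    (h : ∀ u r, colWeight M α u r ≤ colWeight M α w q) : IsMaxCol M (fun p => M w p q) := by
  refine ⟨⟨w, q, rfl⟩, ?_⟩
  rintro _ ⟨u, r, rfl⟩ hle
  have hnn : ∀ p ∈ Finset.univ, 0 ≤ α p * (M u p r - M w p q) := fun p _ =>
    mul_nonneg (hα p).le (sub_nonneg.2 (hle p))
  have hsum : ∑ p, α p * (M u p r - M w p q) = 0 := by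
    refine le_antisymm ?_ (Finset.sum_nonneg hnn)
    have := h u r
    simp only [colWeight, vecMul, dotProduct] at this
    simpa [mul_sub] using this
  funext p
  have hp := (Finset.sum_eq_zero_iff_of_nonneg hnn).1 hsum p (Finset.mem_univ p)
  exact sub_eq_zero.1 ((mul_eq_zero.1 hp).resolve_left (hα p).ne')

/-- The columns of maximum weight are stable under multiplication from the left. -/
lemma colWeight_append_eq_of_max [Fintype σ] [Nonempty σ] (hMm : ∀ u v, M (u ++ v) = M u * M v)
    (hαA : α ᵥ* ((Fintype.card σ : ℝ)⁻¹ • ∑ a : σ, M [a]) = α) {K : ℝ}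
    (hK : ∀ u r, colWeight M α u r ≤ K) {w : List σ} {q : Q} (hw : colWeight M α w q = K)
    (v : List σ) : colWeight M α (v ++ w) q = K := by
  induction v with
  | nil => exact hw
  | cons a v ih =>
    have hsum : ∑ b : σ, (K - colWeight M α ([b] ++ (v ++ w)) q) = 0 := by
      have hA : ∑ b : σ, α ᵥ* M [b] = (Fintype.card σ : ℝ) • α := by
        conv_rhs => rw [← hαA]
        rw [vecMul_smul, smul_smul, mul_inv_cancel₀ (by simp), one_smul, vecMul_sum]
      have hS : ∑ b : σ, colWeight M α ([b] ++ (v ++ w)) q = (Fintype.card σ : ℝ) * K := by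
        have := congrFun (congrArg (fun x => x ᵥ* M (v ++ w)) hA) q
        simp only [sum_vecMul, smul_vecMul, vecMul_vecMul, ← hMm, Finset.sum_apply,
          Pi.smul_apply, smul_eq_mul] at this
        rw [← ih]
        exact this
      rw [Finset.sum_sub_distrib, hS]
      simp
    have ha := (Finset.sum_eq_zero_iff_of_nonneg fun b _ => sub_nonneg.2 (hK _ _)).1 hsum a
      (Finset.mem_univ a)
    exact (sub_eq_zero.1 ha).symm

end Weight

lemma sum_letters_mulVec [Fintype σ] [Nonempty σ] {M : List σ → Matrix Q Q ℝ} {β : Q → ℝ}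
    (hβA : ((Fintype.card σ : ℝ)⁻¹ • ∑ a : σ, M [a]) *ᵥ β = β) :
    ∑ a : σ, M [a] *ᵥ β = (Fintype.card σ : ℝ) • β := by
  conv_rhs => rw [← hβA]
  rw [smul_mulVec, smul_smul, mul_inv_cancel₀ (by simp), one_smul, sum_mulVec]

/-- There is a word all of whose nonzero columns have maximum weight. -/
lemma exists_forall_colWeight_eq_zero_or_max [DecidableEq Q] [Fintype σ] [Nonempty σ]
    {M : List σ → Matrix Q Q ℝ} {α β : Q → ℝ} (hM1 : M [] = 1)
    (hMm : ∀ u v, M (u ++ v) = M u * M v) (hUn : ∀ w i j, M w i j = 0 ∨ M w i j = 1)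
    (hSC : ∀ p q : Q, ∃ w, M w p q = 1) (hα : ∀ q, 0 < α q) (hβ : ∀ q, 0 < β q)
    (hαA : α ᵥ* ((Fintype.card σ : ℝ)⁻¹ • ∑ a : σ, M [a]) = α)
    (hβA : ((Fintype.card σ : ℝ)⁻¹ • ∑ a : σ, M [a]) *ᵥ β = β) {K : ℝ} (hK0 : 0 < K)
    (hK : ∀ u r, colWeight M α u r ≤ K) {x : List σ} {r : Q} (hx : colWeight M α x r = K) :
    ∃ w, ∀ q, colWeight M α w q = 0 ∨ colWeight M α w q = K := by
  -- `S w` is the `β`-mass of the maximum weight columns of `M w`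
  -- `g w a p` counts the maximum weight columns of `M w` that contribute to column `p` of `M (wa)`
  let mx : List σ → Q → ℝ := fun w q => if colWeight M α w q = K then 1 else 0
  let S : List σ → ℝ := fun w => ∑ q, mx w q * β q
  let g : List σ → σ → Q → ℝ := fun w a p => ∑ q, mx w q * M [a] q p
  have hmx0 : ∀ w q, 0 ≤ mx w q := fun w q => by
    simp only [mx]
    split_ifs <;> simp
  have hMnn : ∀ w i j, 0 ≤ M w i j := fun w i j => by rcases hUn w i j with h | h <;> simp [h]
  have hterm : ∀ w a q p, K * (mx w q * M [a] q p) ≤ colWeight M α w q * M [a] q p := by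
    intro w a q p
    rw [← mul_assoc]
    refine mul_le_mul_of_nonneg_right ?_ (hMnn _ _ _)
    simp only [mx]
    split_ifs with h
    · simp [h]
    · simpa using colWeight_nonneg hUn hα w q
  have hKg : ∀ w a p, K * g w a p ≤ K := fun w a p => by
    refine le_trans ?_ (hK (w ++ [a]) p)
    rw [colWeight_append hMm, Finset.mul_sum]
    exact Finset.sum_le_sum fun q _ => hterm w a q p
  have hg : ∀ w a p, g w a p ≤ mx (w ++ [a]) p := fun w a p => by
    by_cases h : g w a p = 0
    · exact h.trans_le (hmx0 _ _)
    · obtain ⟨q, -, hq⟩ := Finset.exists_ne_zero_of_sum_ne_zero h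
      have hq1 : colWeight M α w q = K := by
        by_contra hne
        simp [mx, hne] at hq
      have hq2 := (hUn [a] q p).resolve_left (right_ne_zero_of_mul hq)
      have hp := (hK (w ++ [a]) p).antisymm
        (hq1.symm.trans_le (colWeight_le_append hMm hUn hα hq2))
      have := hKg w a p
      simp only [mx, hp, if_true]
      exact le_of_mul_le_mul_left (by simpa using this) hK0
  have hgS : ∀ w, ∑ a, ∑ p, g w a p * β p = Fintype.card σ * S w := fun w => by
    have h := congrArg (fun y => mx w ⬝ᵥ y) (sum_letters_mulVec hβA)
    simp only [dotProduct_sum, dotProduct_smul, dotProduct_mulVec, smul_eq_mul] at h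
    exact h
  have hgle : ∀ w a, ∑ p, g w a p * β p ≤ S (w ++ [a]) := fun w a =>
    Finset.sum_le_sum fun p _ => mul_le_mul_of_nonneg_right (hg w a p) (hβ p).le
  have hfin : (Set.range S).Finite := by
    refine ((finite_range_of_zero_one M hUn).image fun A =>
      ∑ q, (if (α ᵥ* A) q = K then 1 else 0) * β q).subset ?_
    rintro _ ⟨w, rfl⟩
    exact ⟨M w, ⟨w, rfl⟩, rfl⟩
  obtain ⟨w, hw⟩ := exists_max_of_le_average S hfin fun w => by
    rw [← hgS]
    exact Finset.sum_le_sum fun a _ => hgle w a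
  -- no nonzero column of smaller weight ever gets extended to a maximum weight column
  have hstep : ∀ u a q p, colWeight M α (w ++ u) q ≠ 0 → colWeight M α (w ++ u) q ≠ K →
      M [a] q p = 1 → colWeight M α (w ++ u ++ [a]) p ≠ K := by
    intro u a q p h0 hne hqp hp
    have hsumA : ∑ b, (S (w ++ u ++ [b]) - ∑ p, g (w ++ u) b p * β p) = 0 := by
      rw [Finset.sum_sub_distrib, hgS]
      simp [List.append_assoc, fun v => (hw v).2]
    have hA := (Finset.sum_eq_zero_iff_of_nonneg fun b _ => sub_nonneg.2 (hgle _ _)).1 hsumA a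
      (Finset.mem_univ a)
    have hsumP : ∑ p, (mx (w ++ u ++ [a]) p - g (w ++ u) a p) * β p = 0 := by
      simpa [S, sub_mul] using hA
    have hP := (Finset.sum_eq_zero_iff_of_nonneg fun p _ =>
      mul_nonneg (sub_nonneg.2 (hg _ _ _)) (hβ p).le).1 hsumP p (Finset.mem_univ p)
    have hgp : g (w ++ u) a p = 1 := by
      have := (mul_eq_zero.1 hP).resolve_right (hβ p).ne'
      simp only [mx, hp, if_true] at this
      linarith
    have hlt : K * g (w ++ u) a p < colWeight M α (w ++ u ++ [a]) p := by
      rw [colWeight_append hMm, Finset.mul_sum]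
      refine Finset.sum_lt_sum (fun s _ => hterm (w ++ u) a s p) ⟨q, Finset.mem_univ q, ?_⟩
      simpa [mx, hne, hqp] using (colWeight_nonneg hUn hα (w ++ u) q).lt_of_ne' h0
    rw [hgp, hp, mul_one] at hlt
    exact lt_irrefl _ hlt
  have hword : ∀ v u q p, colWeight M α (w ++ u) q ≠ 0 → colWeight M α (w ++ u) q ≠ K →
      M v q p = 1 → colWeight M α (w ++ u ++ v) p ≠ K := by
    intro v
    induction v with
    | nil =>
      intro u q p h0 hne hqp
      have hpq : q = p := by
        by_contra h
        simp [hM1, one_apply, h] at hqp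
      simpa [← hpq] using hne
    | cons a v ih =>
      intro u q p h0 hne hqp
      have hqp' : ∑ s, M [a] q s * M v s p ≠ 0 := by
        rw [← mul_apply, ← hMm]
        simp [hqp]
      obtain ⟨s, -, hs⟩ := Finset.exists_ne_zero_of_sum_ne_zero hqp'
      have hs1 := (hUn [a] q s).resolve_left (left_ne_zero_of_mul hs)
      have hs2 := (hUn v s p).resolve_left (right_ne_zero_of_mul hs)
      have hs0 : colWeight M α (w ++ u ++ [a]) s ≠ 0 :=
        (((colWeight_nonneg hUn hα _ _).lt_of_ne' h0).trans_le
          (colWeight_le_append hMm hUn hα hs1)).ne'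
      simpa using ih (u ++ [a]) s p (by simpa using hs0)
        (by simpa using hstep u a q s h0 hne hs1) hs2
  refine ⟨w, fun q => ?_⟩
  by_contra! h
  obtain ⟨i, hi⟩ := exists_entry_eq_one_of_colWeight_ne_zero hUn (hx.trans_ne hK0.ne')
  obtain ⟨v, hv⟩ := hSC q i
  have hqr : M (v ++ x) q r = 1 := by
    refine (hUn _ _ _).resolve_left (ne_of_gt ?_)
    rw [hMm, mul_apply]
    refine Finset.sum_pos' (fun s _ => mul_nonneg (hMnn _ _ _) (hMnn _ _ _))
      ⟨i, Finset.mem_univ i, by simp [hv, hi]⟩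
  refine hword (v ++ x) [] q r (by simpa using h.1) (by simpa using h.2) hqr ?_
  rw [← List.append_assoc]
  exact colWeight_append_eq_of_max hMm hαA hK hx _

end UFA

theorem V_subset_span_maxCol {Q σ : Type*} [Fintype Q] [DecidableEq Q] [Nonempty Q]
    [Fintype σ] [Nonempty σ]
    (M : List σ → Matrix Q Q ℝ)
    (hM0 : M [] = 1) (hMm : ∀ u v, M (u ++ v) = M u * M v)
    (hUn : ∀ w i j, M w i j = 0 ∨ M w i j = 1)
    (hComp : ∀ w, M w ≠ 0)
    (hSC : ∀ p q : Q, ∃ w, M w p q = 1)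
    (α β : Q → ℝ) (hα : ∀ q, 0 < α q) (hβ : ∀ q, 0 < β q)
    (hαA : α ᵥ* ((Fintype.card σ : ℝ)⁻¹ • ∑ a : σ, M [a]) = α)
    (hβA : ((Fintype.card σ : ℝ)⁻¹ • ∑ a : σ, M [a]) *ᵥ β = β)
    (hαβ : α ⬝ᵥ β = 1)
 :
    Submodule.span ℝ {y : Q → ℝ | ∃ w : List σ, y = M w *ᵥ β}
      ≤ Submodule.span ℝ {y : Q → ℝ | UFA.IsMaxCol M y} := by
  obtain ⟨_, ⟨⟨x, r⟩, hx, rfl⟩, hmax⟩ :=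
    (((UFA.finite_range_of_zero_one M hUn).prod (Set.finite_univ (α := Q))).image
      fun A => (α ᵥ* A.1) A.2).exists_maximal
        ⟨_, ⟨(M [], Classical.arbitrary Q), ⟨⟨[], rfl⟩, trivial⟩, rfl⟩⟩
  obtain ⟨⟨x, rfl⟩, -⟩ := hx
  have hK : ∀ u s, UFA.colWeight M α u s ≤ UFA.colWeight M α x r := fun u s => by
    by_contra! h
    exact h.not_ge (hmax ⟨(M u, s), ⟨⟨u, rfl⟩, trivial⟩, rfl⟩ h.le)
  have hK0 : 0 < UFA.colWeight M α x r := by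
    have q : Q := Classical.arbitrary Q
    have h := hK [] q
    simp only [UFA.colWeight, hM0, vecMul_one] at h
    exact (hα q).trans_le h
  obtain ⟨w, hw⟩ := UFA.exists_forall_colWeight_eq_zero_or_max hM0 hMm hUn hSC hα hβ hαA hβA
    hK0 hK rfl
  have hmem : ∀ u, M (u ++ w) *ᵥ β ∈ Submodule.span ℝ {y : Q → ℝ | UFA.IsMaxCol M y} := by
    intro u
    rw [mulVec_eq_sum]
    refine Submodule.sum_mem _ fun q _ => ?_
    rw [op_smul_eq_smul]
    refine Submodule.smul_mem _ _ ?_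
    rcases hw q with h | h
    · have hz : (M (u ++ w))ᵀ q = 0 := by
        funext p
        simp [hMm, mul_apply, UFA.entry_eq_zero_of_colWeight_eq_zero hUn hα h]
      simp [hz]
    · refine Submodule.subset_span (UFA.isMaxCol_of_colWeight_max hα fun v s => ?_)
      rw [UFA.colWeight_append_eq_of_max hMm hαA hK h u]
      exact hK v s
  have hle : ∀ φ : (Q → ℝ) →ₗ[ℝ] ℝ,
      Submodule.span ℝ {y : Q → ℝ | UFA.IsMaxCol M y} ≤ LinearMap.ker φ →
      ∀ u, φ (M u *ᵥ β) ≤ 0 := by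
    intro φ hφ u
    obtain ⟨v, hv⟩ := UFA.exists_max_of_le_average (fun u => φ (M u *ᵥ β))
      (((UFA.finite_range_of_zero_one M hUn).image fun A => φ (A *ᵥ β)).subset (by
        rintro _ ⟨u, rfl⟩
        exact ⟨M u, ⟨u, rfl⟩, rfl⟩)) fun u => by
      have h := congrArg (fun y => φ (M u *ᵥ y)) (UFA.sum_letters_mulVec hβA)
      simp only [mulVec_sum, mulVec_smul, map_sum, map_smul, mulVec_mulVec, ← hMm,
        smul_eq_mul] at h
      exact h.ge
    exact ((hv w).1 u).trans_eq (hφ (hmem v))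
  refine Submodule.span_le.2 ?_
  rintro _ ⟨u, rfl⟩
  by_contra hu
  obtain ⟨φ, hφ, hker⟩ := Submodule.exists_le_ker_of_notMem hu
  have hneg := hle (-φ) (fun y hy => by simpa using hker hy) u
  exact hφ (le_antisymm (hle φ hker u) (by simpa using hneg))
end

section
/- V = span(MCol) if and only if rank_un(M) = 1. -/
open Matrix

namespace UFA

variable {Q σ : Type*}

theorem eq_zero_of_rankUnMat_eq_zero [Fintype Q] {A : Matrix Q Q ℝ}
    (hA : ∀ i j, A i j = 0 ∨ A i j = 1)
    (h : rankUnMat A = 0) : A = 0 := by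
  classical
  rcases Nat.sInf_eq_zero.1 h with ⟨C, R, -, -, rfl⟩ | hempty
  · ext i j
    simp [Matrix.mul_apply]
  · have e := Fintype.equivFin Q
    refine absurd hempty (Set.Nonempty.ne_empty ⟨Fintype.card Q, A.submatrix id e.symm,
      (1 : Matrix Q Q ℝ).submatrix e.symm id, fun i j => hA i _, fun i j => ?_, ?_⟩)
    · rw [Matrix.submatrix_apply, Matrix.one_apply]
      split_ifs <;> simp
    · rw [Matrix.submatrix_mul_equiv, mul_one, Matrix.submatrix_id_id]

theorem rankUnMat_vecMulVec_le_one {c r : Q → ℝ} (hc : ∀ q, c q = 0 ∨ c q = 1)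
    (hr : ∀ q, r q = 0 ∨ r q = 1) : rankUnMat (Matrix.vecMulVec c r) ≤ 1 :=
  Nat.sInf_le ⟨Matrix.of fun i _ => c i, Matrix.of fun _ j => r j, fun i _ => hc i, fun _ j => hr j,
    Matrix.ext fun i j => by simp [Matrix.mul_apply, Matrix.vecMulVec_apply]⟩

theorem exists_eq_vecMulVec_of_rankUn_eq_one {M : List σ → Matrix Q Q ℝ} (h : rankUn M = 1) :
    ∃ m c r, (∀ q, c q = 0 ∨ c q = 1) ∧ (∀ q, r q = 0 ∨ r q = 1) ∧
      M m = Matrix.vecMulVec c r := by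
  obtain ⟨m, hm⟩ := Nat.sInf_mem (Set.range_nonempty fun w => rankUnMat (M w))
  have hm1 : rankUnMat (M m) = 1 := hm.trans h
  have hmem := Nat.sInf_mem (Nat.nonempty_of_sInf_eq_succ hm1)
  change rankUnMat (M m) ∈ _ at hmem
  rw [hm1] at hmem
  obtain ⟨C, R, hC, hR, hCR⟩ := hmem
  refine ⟨m, fun q => C q 0, fun q => R 0 q, fun q => hC q 0, fun q => hR 0 q, ?_⟩
  rw [hCR]
  ext i j
  simp [Matrix.mul_apply, Matrix.vecMulVec_apply]

variable [Fintype Q] [DecidableEq Q]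

/-- `M` is a strongly connected unambiguous monoid morphism. -/
structure IsConnectedMorphism (M : List σ → Matrix Q Q ℝ) : Prop where
  map_nil : M [] = 1
  map_append : ∀ u v, M (u ++ v) = M u * M v
  zero_one : ∀ w i j, M w i j = 0 ∨ M w i j = 1
  connected : ∀ p q, ∃ w, M w p q = 1

/-- A column of maximum `α`-weight. -/
def IsHeavyCol (M : List σ → Matrix Q Q ℝ) (α y : Q → ℝ) : Prop :=
  IsCol M y ∧ ∀ y', IsCol M y' → α ⬝ᵥ y' ≤ α ⬝ᵥ y

/-- The morphism obtained by reversing words and transposing matrices. -/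
def reversal (M : List σ → Matrix Q Q ℝ) (w : List σ) : Matrix Q Q ℝ := (M w.reverse)ᵀ

theorem IsHeavyCol.isMaxCol {Q σ : Type*} [Fintype Q] {M : List σ → Matrix Q Q ℝ}
    {α y : Q → ℝ} (hα : ∀ q, 0 < α q) (hy : IsHeavyCol M α y) : IsMaxCol M y := by
  refine ⟨hy.1, fun y' hy' hle => ?_⟩
  have hterm : ∀ q ∈ Finset.univ, α q * y q ≤ α q * y' q := fun q _ =>
    mul_le_mul_of_nonneg_left (hle q) (hα q).le
  have heq := (Finset.sum_eq_sum_iff_of_le hterm).1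
    (le_antisymm (Finset.sum_le_sum hterm) (hy.2 y' hy'))
  funext q
  exact (mul_left_cancel₀ (hα q).ne' (heq q (Finset.mem_univ q))).symm

theorem average_mulVec {Q σ : Type*} [Fintype Q] [Fintype σ] (M : List σ → Matrix Q Q ℝ)
    (x : Q → ℝ) :
    ((Fintype.card σ : ℝ)⁻¹ • ∑ a : σ, M [a]) *ᵥ x
      = (Fintype.card σ : ℝ)⁻¹ • ∑ a : σ, M [a] *ᵥ x := by
  rw [Matrix.smul_mulVec, Matrix.sum_mulVec]

theorem vecMul_average_reversal {Q σ : Type*} [Fintype Q] [Fintype σ]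
    (M : List σ → Matrix Q Q ℝ) (x : Q → ℝ) :
    x ᵥ* ((Fintype.card σ : ℝ)⁻¹ • ∑ a : σ, reversal M [a])
      = ((Fintype.card σ : ℝ)⁻¹ • ∑ a : σ, M [a]) *ᵥ x := by
  rw [← Matrix.vecMul_transpose, Matrix.transpose_smul, Matrix.transpose_sum]
  rfl

section Columns

variable {M : List σ → Matrix Q Q ℝ} {α β y c : Q → ℝ}

theorem IsConnectedMorphism.reversal (h : IsConnectedMorphism M) :
    IsConnectedMorphism (reversal M) where
  map_nil := by simp [UFA.reversal, h.map_nil]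
  map_append u v := by simp [UFA.reversal, h.map_append]
  zero_one w i j := h.zero_one w.reverse j i
  connected p q := by
    obtain ⟨w, hw⟩ := h.connected q p
    exact ⟨w.reverse, by simpa [UFA.reversal] using hw⟩

theorem IsConnectedMorphism.nonneg (h : IsConnectedMorphism M) (w : List σ) (i j : Q) :
    0 ≤ M w i j := by
  rcases h.zero_one w i j with h | h <;> simp [h]

theorem isCol_iff : IsCol M y ↔ ∃ w q, y = M w *ᵥ Pi.single q 1 := by
  simp only [IsCol, Matrix.mulVec_single_one]
  rfl

theorem IsCol.mulVec (h : IsConnectedMorphism M) (hy : IsCol M y) (u : List σ) :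
    IsCol M (M u *ᵥ y) := by
  rw [isCol_iff] at hy ⊢
  obtain ⟨w, q, rfl⟩ := hy
  exact ⟨u ++ w, q, by rw [h.map_append, Matrix.mulVec_mulVec]⟩

theorem IsCol.zero_one (h : IsConnectedMorphism M) (hy : IsCol M y) (p : Q) :
    y p = 0 ∨ y p = 1 := by
  obtain ⟨w, q, rfl⟩ := hy
  exact h.zero_one w p q

theorem IsCol.nonneg (h : IsConnectedMorphism M) (hy : IsCol M y) (p : Q) : 0 ≤ y p := by
  rcases hy.zero_one h p with h | h <;> simp [h]

theorem isCol_single (h : IsConnectedMorphism M) (q : Q) : IsCol M (Pi.single q 1) :=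
  isCol_iff.2 ⟨[], q, by rw [h.map_nil, Matrix.one_mulVec]⟩

theorem mulVec_mono (h : IsConnectedMorphism M) {x y : Q → ℝ} (hxy : x ≤ y) (w : List σ) :
    M w *ᵥ x ≤ M w *ᵥ y := fun p =>
  Finset.sum_le_sum fun q _ => mul_le_mul_of_nonneg_left (hxy q) (h.nonneg w p q)

theorem exists_isHeavyCol [Nonempty Q] (h : IsConnectedMorphism M) (α : Q → ℝ) :
    ∃ y, IsHeavyCol M α y := by
  have hfin : {y | IsCol M y}.Finite := by
    refine (Set.Finite.pi' (fun _ : Q => (Set.toFinite ({0, 1} : Set ℝ)))).subset ?_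
    intro y hy p
    exact IsCol.zero_one h hy p
  obtain ⟨y, hy, hmax⟩ := hfin.exists_maximalFor (fun y => α ⬝ᵥ y) _
    ⟨_, isCol_single h (Classical.arbitrary Q)⟩
  refine ⟨y, hy, fun y' hy' => ?_⟩
  rcases le_total (α ⬝ᵥ y') (α ⬝ᵥ y) with hle | hle
  · exact hle
  · exact hmax hy' hle

theorem IsHeavyCol.exists_eq_one [Nonempty Q] (h : IsConnectedMorphism M) (hα : ∀ q, 0 < α q)
    (hy : IsHeavyCol M α y) : ∃ p, y p = 1 := by
  by_contra! hne
  have hy0 : y = 0 := funext fun p => (hy.1.zero_one h p).resolve_right (hne p)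
  have hle := hy.2 _ (isCol_single h (Classical.arbitrary Q))
  simp only [dotProduct_single, mul_one, hy0, dotProduct_zero] at hle
  exact absurd (hα _) hle.not_gt

/-- Prepending a suitable word to a column makes it pass through any prescribed state. -/
theorem IsCol.exists_single_le (h : IsConnectedMorphism M) (hc : IsCol M c) {p : Q}
    (hp : c p = 1) (q : Q) : ∃ v, Pi.single q 1 ≤ M v *ᵥ c := by
  obtain ⟨v, hv⟩ := h.connected q p
  refine ⟨v, fun r => ?_⟩
  by_cases hr : r = q
  · subst hr
    have := Finset.single_le_sum (f := fun j => M v r j * c j)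
      (fun j _ => mul_nonneg (h.nonneg v r j) (hc.nonneg h j)) (Finset.mem_univ p)
    simpa [hv, hp, Matrix.mulVec, dotProduct] using this
  · simpa [hr] using (hc.mulVec h v).nonneg h r

theorem IsMaxCol.exists_eq_mulVec (h : IsConnectedMorphism M) (hy : IsMaxCol M y)
    (hc : IsCol M c) {p : Q} (hp : c p = 1) : ∃ u, y = M u *ᵥ c := by
  obtain ⟨x, q, hx⟩ := isCol_iff.1 hy.1
  obtain ⟨v, hv⟩ := hc.exists_single_le h hp q
  refine ⟨x ++ v, (hy.2 _ (hc.mulVec h _) ?_).symm⟩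
  rw [h.map_append, ← Matrix.mulVec_mulVec, hx]
  exact mulVec_mono h hv x

/-- If a row `r` meets every column of maximum weight exactly once, then some matrix of the monoid
is an outer product. -/
theorem exists_eq_vecMulVec (h : IsConnectedMorphism M) (hα : ∀ q, 0 < α q)
    (hcover : ∀ q, ∃ y, IsHeavyCol M α y ∧ y q = 1)
    (hheavy : ∀ u y, IsHeavyCol M α y → IsHeavyCol M α (M u *ᵥ y))
    {r : Q → ℝ} (hr : IsCol (reversal M) r) (hc : IsHeavyCol M α c)
    (hone : ∀ y, IsHeavyCol M α y → r ⬝ᵥ y = 1) : ∃ m, M m = Matrix.vecMulVec c r := by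
  obtain ⟨x, q, hx⟩ := hc.1
  obtain ⟨w, p, hw⟩ := id hr
  obtain ⟨v, hv⟩ := h.connected q p
  set m := x ++ (v ++ w.reverse) with hm
  have hle : ∀ i j, c i * r j ≤ M m i j := by
    intro i j
    have h1 : M v q p * M w.reverse p j ≤ M (v ++ w.reverse) q j := by
      rw [h.map_append, Matrix.mul_apply]
      exact Finset.single_le_sum (f := fun k => M v q k * M w.reverse k j)
        (fun k _ => mul_nonneg (h.nonneg _ _ _) (h.nonneg _ _ _)) (Finset.mem_univ p)
    have h2 : M x i q * M (v ++ w.reverse) q j ≤ M m i j := by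
      rw [hm, h.map_append x, Matrix.mul_apply]
      exact Finset.single_le_sum (f := fun k => M x i k * M (v ++ w.reverse) k j)
        (fun k _ => mul_nonneg (h.nonneg _ _ _) (h.nonneg _ _ _)) (Finset.mem_univ q)
    rw [hv, one_mul] at h1
    rw [hx, hw]
    exact (mul_le_mul_of_nonneg_left h1 (h.nonneg x i q)).trans h2
  refine ⟨m, Matrix.ext fun i j => ?_⟩
  obtain ⟨y, hy, hyj⟩ := hcover j
  have hsum : ∀ i, ∑ k, c i * r k * y k = c i := fun i => by
    simp_rw [mul_assoc]
    rw [← Finset.mul_sum]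
    exact (congrArg (c i * ·) (hone y hy)).trans (mul_one _)
  have hterm : ∀ i, ∀ k ∈ Finset.univ, c i * r k * y k ≤ M m i k * y k := fun i k _ =>
    mul_le_mul_of_nonneg_right (hle i k) (hy.1.nonneg h k)
  have heq : M m *ᵥ y = c := (hc.isMaxCol hα).2 _ (hheavy m y hy).1 fun i =>
    (hsum i).ge.trans (Finset.sum_le_sum (hterm i))
  have := (Finset.sum_eq_sum_iff_of_le (hterm i)).1 ((hsum i).trans (congrFun heq i).symm) j
    (Finset.mem_univ j)
  rw [hyj, mul_one, mul_one] at this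
  exact this.symm

theorem span_isMaxCol_le_of_eq_vecMulVec (h : IsConnectedMorphism M) (hβ : ∀ q, 0 < β q)
    {m : List σ} {r : Q → ℝ} (hm : M m = Matrix.vecMulVec c r) (hm0 : M m ≠ 0)
    (hc : ∀ q, c q = 0 ∨ c q = 1) (hr : ∀ q, r q = 0 ∨ r q = 1) :
    Submodule.span ℝ {y | IsMaxCol M y}
      ≤ Submodule.span ℝ {y : Q → ℝ | ∃ w : List σ, y = M w *ᵥ β} := by
  obtain ⟨p, q, hpq⟩ : ∃ p q, c p * r q ≠ 0 := by
    by_contra! hz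
    exact hm0 (Matrix.ext fun i j => by rw [hm, Matrix.vecMulVec_apply, hz, Matrix.zero_apply])
  have hcp := (hc p).resolve_left (left_ne_zero_of_mul hpq)
  have hrq := (hr q).resolve_left (right_ne_zero_of_mul hpq)
  have hcol : IsCol M c := ⟨m, q, funext fun i => by
    rw [hm, Matrix.vecMulVec_apply, hrq, mul_one]⟩
  have hpos : 0 < r ⬝ᵥ β := by
    have hnn : ∀ k, 0 ≤ r k := fun k => by rcases hr k with h | h <;> simp [h]
    refine Finset.sum_pos' (fun k _ => mul_nonneg (hnn k) (hβ k).le) ⟨q, Finset.mem_univ q, ?_⟩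
    rw [hrq, one_mul]
    exact hβ q
  rw [Submodule.span_le]
  intro y hy
  obtain ⟨u, rfl⟩ := IsMaxCol.exists_eq_mulVec h hy hcol hcp
  refine (Submodule.smul_mem_iff _ hpos.ne').1 (Submodule.subset_span ⟨u ++ m, ?_⟩)
  rw [h.map_append, ← Matrix.mulVec_mulVec, hm, Matrix.vecMulVec_mulVec,
    ← Matrix.mulVec_smul]
  simp

variable [Fintype σ] [Nonempty σ]

theorem IsHeavyCol.mulVec (h : IsConnectedMorphism M)
    (hαA : α ᵥ* ((Fintype.card σ : ℝ)⁻¹ • ∑ a : σ, M [a]) = α)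
    (hy : IsHeavyCol M α y) (u : List σ) : IsHeavyCol M α (M u *ᵥ y) := by
  have hcard : (Fintype.card σ : ℝ) ≠ 0 := Nat.cast_ne_zero.2 Fintype.card_ne_zero
  induction u with
  | nil => simpa [h.map_nil] using hy
  | cons a u ih =>
    rw [← List.singleton_append, h.map_append, ← Matrix.mulVec_mulVec]
    set x := M u *ᵥ y
    have hsum : ∑ b : σ, α ⬝ᵥ (M [b] *ᵥ x) = ∑ _b : σ, α ⬝ᵥ x := by
      have h1 : α ⬝ᵥ x = (Fintype.card σ : ℝ)⁻¹ * ∑ b : σ, α ⬝ᵥ (M [b] *ᵥ x) := by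
        conv_lhs => rw [← hαA]
        rw [← Matrix.dotProduct_mulVec, average_mulVec, dotProduct_smul, dotProduct_sum,
          smul_eq_mul]
      rw [Finset.sum_const, Finset.card_univ, nsmul_eq_mul, h1, mul_inv_cancel_left₀ hcard]
    have heq := (Finset.sum_eq_sum_iff_of_le
      (fun b _ => ih.2 _ (ih.1.mulVec h [b]))).1 hsum a (Finset.mem_univ a)
    exact ⟨ih.1.mulVec h [a], fun y' hy' => heq ▸ ih.2 y' hy'⟩

theorem IsMaxCol.isHeavyCol [Nonempty Q] (h : IsConnectedMorphism M) (hα : ∀ q, 0 < α q)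
    (hαA : α ᵥ* ((Fintype.card σ : ℝ)⁻¹ • ∑ a : σ, M [a]) = α)
    (hy : IsMaxCol M y) : IsHeavyCol M α y := by
  obtain ⟨c, hc⟩ := exists_isHeavyCol h α
  obtain ⟨p, hp⟩ := hc.exists_eq_one h hα
  obtain ⟨u, rfl⟩ := hy.exists_eq_mulVec h hc.1 hp
  exact hc.mulVec h hαA u

theorem exists_isHeavyCol_eq_one [Nonempty Q] (h : IsConnectedMorphism M) (hα : ∀ q, 0 < α q)
    (hαA : α ᵥ* ((Fintype.card σ : ℝ)⁻¹ • ∑ a : σ, M [a]) = α) (q : Q) :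
    ∃ y, IsHeavyCol M α y ∧ y q = 1 := by
  obtain ⟨c, hc⟩ := exists_isHeavyCol h α
  obtain ⟨p, hp⟩ := hc.exists_eq_one h hα
  obtain ⟨v, hv⟩ := hc.1.exists_single_le h hp q
  refine ⟨_, hc.mulVec h hαA v, ((hc.1.mulVec h v).zero_one h q).resolve_left fun h0 => ?_⟩
  have := hv q
  rw [h0, Pi.single_eq_same] at this
  exact absurd this (by norm_num)

/-- The fixed space of the averaged matrix is spanned by its positive fixed vector. -/
theorem eq_smul_of_average_mulVec_eq [Nonempty Q] (h : IsConnectedMorphism M)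
    (hβ : ∀ q, 0 < β q)
    (hβA : ((Fintype.card σ : ℝ)⁻¹ • ∑ a : σ, M [a]) *ᵥ β = β) {x : Q → ℝ}
    (hx : ((Fintype.card σ : ℝ)⁻¹ • ∑ a : σ, M [a]) *ᵥ x = x) : ∃ t : ℝ, x = t • β := by
  obtain ⟨q₀, hq₀⟩ := Finite.exists_min fun q => x q / β q
  set t := x q₀ / β q₀
  set z := x - t • β with hz
  have hcard : (Fintype.card σ : ℝ)⁻¹ ≠ 0 :=
    inv_ne_zero (Nat.cast_ne_zero.2 Fintype.card_ne_zero)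
  have hz0 : ∀ q, 0 ≤ z q := fun q => by
    have := (le_div_iff₀ (hβ q)).1 (hq₀ q)
    simpa [hz] using this
  have hzq : z q₀ = 0 := by
    simp [hz, t, (hβ q₀).ne']
  have hzA : ((Fintype.card σ : ℝ)⁻¹ • ∑ a : σ, M [a]) *ᵥ z = z := by
    rw [hz, Matrix.mulVec_sub, Matrix.mulVec_smul, hx, hβA]
  have hstep : ∀ a q, z q = 0 → ∀ p, M [a] q p * z p = 0 := by
    intro a q hq p
    have h1 := congrFun hzA q
    rw [average_mulVec, hq, Pi.smul_apply, Finset.sum_apply, smul_eq_zero] at h1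
    have hnn : ∀ b p, 0 ≤ M [b] q p * z p := fun b p => mul_nonneg (h.nonneg _ _ _) (hz0 p)
    have h2 := (Finset.sum_eq_zero_iff_of_nonneg
      (fun b _ => Finset.sum_nonneg fun p _ => hnn b p)).1 (h1.resolve_left hcard) a
      (Finset.mem_univ a)
    exact (Finset.sum_eq_zero_iff_of_nonneg (fun p _ => hnn a p)).1 h2 p (Finset.mem_univ p)
  have hword : ∀ w q p, z q = 0 → M w q p = 1 → z p = 0 := by
    intro w
    induction w with
    | nil =>
      intro q p hq hw
      rw [h.map_nil, Matrix.one_apply] at hw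
      split_ifs at hw with hqp
      · exact hqp ▸ hq
      · exact absurd hw (by norm_num)
    | cons a w ih =>
      intro q p hq hw
      rw [← List.singleton_append, h.map_append, Matrix.mul_apply] at hw
      obtain ⟨r, -, hr⟩ := Finset.exists_ne_zero_of_sum_ne_zero (hw.trans_ne one_ne_zero)
      have hzr := (mul_eq_zero.1 (hstep a q hq r)).resolve_left (left_ne_zero_of_mul hr)
      exact ih r p hzr ((h.zero_one w r p).resolve_left (right_ne_zero_of_mul hr))
  refine ⟨t, sub_eq_zero.1 (funext fun p => ?_)⟩
  obtain ⟨w, hw⟩ := h.connected q₀ p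
  exact hword w q₀ p hzq hw

theorem mulVec_mem_span_isMaxCol [Nonempty Q] (h : IsConnectedMorphism M)
    (hα : ∀ q, 0 < α q)
    (hαA : α ᵥ* ((Fintype.card σ : ℝ)⁻¹ • ∑ a : σ, M [a]) = α) (u : List σ)
    (hy : y ∈ Submodule.span ℝ {y | IsMaxCol M y}) :
    M u *ᵥ y ∈ Submodule.span ℝ {y | IsMaxCol M y} := by
  induction hy using Submodule.span_induction with
  | mem x hx =>
    exact Submodule.subset_span
      (((IsMaxCol.isHeavyCol h hα hαA hx).mulVec h hαA u).isMaxCol hα)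
  | zero => simp
  | add x y _ _ hx hy => rw [Matrix.mulVec_add]; exact add_mem hx hy
  | smul t x _ hx => rw [Matrix.mulVec_smul]; exact Submodule.smul_mem _ _ hx

theorem span_mulVec_le_span_isMaxCol [Nonempty Q] (h : IsConnectedMorphism M)
    (hα : ∀ q, 0 < α q) (hβ : ∀ q, 0 < β q)
    (hαA : α ᵥ* ((Fintype.card σ : ℝ)⁻¹ • ∑ a : σ, M [a]) = α)
    (hβA : ((Fintype.card σ : ℝ)⁻¹ • ∑ a : σ, M [a]) *ᵥ β = β) :
    Submodule.span ℝ {y : Q → ℝ | ∃ w : List σ, y = M w *ᵥ β}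
      ≤ Submodule.span ℝ {y | IsMaxCol M y} := by
  set W := Submodule.span ℝ {y | IsMaxCol M y} with hW
  set A := (Fintype.card σ : ℝ)⁻¹ • ∑ a : σ, M [a] with hA
  suffices hβW : β ∈ W by
    rw [Submodule.span_le]
    rintro _ ⟨w, rfl⟩
    exact mulVec_mem_span_isMaxCol h hα hαA w hβW
  let D : (Q → ℝ) →ₗ[ℝ] Q → ℝ := A.mulVecLin - LinearMap.id
  have hAW : ∀ x ∈ W, D x ∈ W := fun x hx => by
    rw [LinearMap.sub_apply, Matrix.mulVecLin_apply, hA, average_mulVec]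
    exact sub_mem (Submodule.smul_mem _ _ (Submodule.sum_mem _ fun a _ =>
      mulVec_mem_span_isMaxCol h hα hαA [a] hx)) hx
  obtain ⟨y, hy⟩ := exists_isHeavyCol h α
  have hyW : y ∈ W := Submodule.subset_span (hy.isMaxCol hα)
  have hypos : 0 < α ⬝ᵥ y := by
    have := hy.2 _ (isCol_single h (Classical.arbitrary Q))
    rw [dotProduct_single, mul_one] at this
    exact (hα _).trans_le this
  have hninj : ¬ Function.Injective (D.restrict hAW) := by
    intro hinj
    obtain ⟨x, hx⟩ := LinearMap.injective_iff_surjective.1 hinj ⟨y, hyW⟩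
    have hx' : A *ᵥ (x : Q → ℝ) - x = y := congrArg Subtype.val hx
    rw [← hx', dotProduct_sub, Matrix.dotProduct_mulVec, hαA, sub_self] at hypos
    exact hypos.false
  rw [injective_iff_map_eq_zero] at hninj
  push Not at hninj
  obtain ⟨⟨x, hxW⟩, hx, hx0⟩ := hninj
  have hx' : A *ᵥ x - x = 0 := congrArg Subtype.val hx
  obtain ⟨t, rfl⟩ := eq_smul_of_average_mulVec_eq h hβ hβA (sub_eq_zero.1 hx')
  have ht : t ≠ 0 := by
    rintro rfl
    exact hx0 (Subtype.ext (zero_smul ℝ β))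
  exact (Submodule.smul_mem_iff W ht).1 hxW

/-- All rows of maximum `β`-weight define the same linear functional on the span of the vectors
`M w *ᵥ β`. -/
theorem dotProduct_eq_of_mem_span (h : IsConnectedMorphism M)
    (hβA : ((Fintype.card σ : ℝ)⁻¹ • ∑ a : σ, M [a]) *ᵥ β = β) {r r' v : Q → ℝ}
    (hr : IsHeavyCol (reversal M) β r) (hr' : IsHeavyCol (reversal M) β r')
    (hv : v ∈ Submodule.span ℝ {y : Q → ℝ | ∃ w : List σ, y = M w *ᵥ β}) :
    r ⬝ᵥ v = r' ⬝ᵥ v := by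
  have hβA' := (vecMul_average_reversal M β).trans hβA
  have key : ∀ (s : Q → ℝ) u, s ⬝ᵥ (M u *ᵥ β) = β ⬝ᵥ (reversal M u.reverse *ᵥ s) := by
    intro s u
    rw [Matrix.dotProduct_mulVec, dotProduct_comm, reversal, List.reverse_reverse,
      Matrix.mulVec_transpose]
  induction hv using Submodule.span_induction with
  | mem x hx =>
    obtain ⟨u, rfl⟩ := hx
    rw [key, key]
    have h1 := hr.mulVec h.reversal hβA' u.reverse
    have h2 := hr'.mulVec h.reversal hβA' u.reverse
    exact le_antisymm (h2.2 _ h1.1) (h1.2 _ h2.1)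
  | zero => simp
  | add x y _ _ hx hy => rw [dotProduct_add, dotProduct_add, hx, hy]
  | smul t x _ hx => rw [dotProduct_smul, dotProduct_smul, hx]

theorem exists_eq_vecMulVec_of_span_eq [Nonempty Q] (h : IsConnectedMorphism M)
    (hα : ∀ q, 0 < α q) (hβ : ∀ q, 0 < β q)
    (hαA : α ᵥ* ((Fintype.card σ : ℝ)⁻¹ • ∑ a : σ, M [a]) = α)
    (hβA : ((Fintype.card σ : ℝ)⁻¹ • ∑ a : σ, M [a]) *ᵥ β = β)
    (hspan : Submodule.span ℝ {y : Q → ℝ | ∃ w : List σ, y = M w *ᵥ β}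
      = Submodule.span ℝ {y | IsMaxCol M y}) :
    ∃ m c r, (∀ q, c q = 0 ∨ c q = 1) ∧ (∀ q, r q = 0 ∨ r q = 1) ∧
      M m = Matrix.vecMulVec c r := by
  have hβA' := (vecMul_average_reversal M β).trans hβA
  obtain ⟨c, hc⟩ := exists_isHeavyCol h α
  obtain ⟨r, hr⟩ := exists_isHeavyCol h.reversal β
  have hone : ∀ y, IsHeavyCol M α y → r ⬝ᵥ y = 1 := by
    intro y hy
    have hyV : y ∈ Submodule.span ℝ {y : Q → ℝ | ∃ w : List σ, y = M w *ᵥ β} :=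
      hspan ▸ Submodule.subset_span (hy.isMaxCol hα)
    obtain ⟨p, hp⟩ := hy.exists_eq_one h hα
    obtain ⟨r', hr', hr'p⟩ := exists_isHeavyCol_eq_one h.reversal hβ hβA' p
    rw [dotProduct_eq_of_mem_span h hβA hr hr' hyV]
    have hge : 1 ≤ r' ⬝ᵥ y := by
      have := Finset.single_le_sum (f := fun k => r' k * y k)
        (fun k _ => mul_nonneg (hr'.1.nonneg h.reversal k) (hy.1.nonneg h k)) (Finset.mem_univ p)
      simpa [hr'p, hp, dotProduct] using this
    have h01 : r' ⬝ᵥ y = 0 ∨ r' ⬝ᵥ y = 1 := by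
      obtain ⟨w, q, rfl⟩ := hr'.1
      exact (hy.1.mulVec h w.reverse).zero_one h q
    exact h01.resolve_left fun h0 => absurd (h0 ▸ hge) (by norm_num)
  obtain ⟨m, hm⟩ := exists_eq_vecMulVec h hα (exists_isHeavyCol_eq_one h hα hαA)
    (fun u y hy => hy.mulVec h hαA u) hr.1 hc hone
  exact ⟨m, c, r, hc.1.zero_one h, hr.1.zero_one h.reversal, hm⟩

end Columns

end UFA

theorem V_eq_span_maxCol_iff_rank_one {Q σ : Type*} [Fintype Q] [DecidableEq Q] [Nonempty Q]
    [Fintype σ] [Nonempty σ]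
    (M : List σ → Matrix Q Q ℝ)
    (hM0 : M [] = 1) (hMm : ∀ u v, M (u ++ v) = M u * M v)
    (hUn : ∀ w i j, M w i j = 0 ∨ M w i j = 1)
    (hComp : ∀ w, M w ≠ 0)
    (hSC : ∀ p q : Q, ∃ w, M w p q = 1)
    (α β : Q → ℝ) (hα : ∀ q, 0 < α q) (hβ : ∀ q, 0 < β q)
    (hαA : α ᵥ* ((Fintype.card σ : ℝ)⁻¹ • ∑ a : σ, M [a]) = α)
    (hβA : ((Fintype.card σ : ℝ)⁻¹ • ∑ a : σ, M [a]) *ᵥ β = β)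
    (hαβ : α ⬝ᵥ β = 1)
 :
    Submodule.span ℝ {y : Q → ℝ | ∃ w : List σ, y = M w *ᵥ β}
      = Submodule.span ℝ {y : Q → ℝ | UFA.IsMaxCol M y}
    ↔ UFA.rankUn M = 1 := by
  have h : UFA.IsConnectedMorphism M := ⟨hM0, hMm, hUn, hSC⟩
  constructor
  · intro hspan
    obtain ⟨m, c, r, hc, hr, hm⟩ :=
      UFA.exists_eq_vecMulVec_of_span_eq h hα hβ hαA hβA hspan
    refine le_antisymm ((Nat.sInf_le (Set.mem_range_self m)).trans ?_) (Nat.one_le_iff_ne_zero.2 fun h0 => ?_)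
    · simpa only [hm] using UFA.rankUnMat_vecMulVec_le_one hc hr
    · rcases Nat.sInf_eq_zero.1 h0 with ⟨w, hw⟩ | hempty
      · exact hComp w (UFA.eq_zero_of_rankUnMat_eq_zero (hUn w) hw)
      · exact (Set.range_nonempty _).ne_empty hempty
  · intro hrank
    obtain ⟨m, c, r, hc, hr, hm⟩ := UFA.exists_eq_vecMulVec_of_rankUn_eq_one hrank
    exact le_antisymm (UFA.span_mulVec_le_span_isMaxCol h hα hβ hαA hβA)
      (UFA.span_isMaxCol_le_of_eq_vecMulVec h hβ hm (hComp m) hc hr)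
end

section
/- U = U', i.e., span{α^T M(w) − α^T : w ∈ Σ*} = span{α^T M'(w) : w ∈ Σ⁺}, where for a letter a one sets M'(a) := M(a) − I and M' is extended multiplicatively to nonempty words by M'(a₁⋯a_k) := M'(a₁)⋯M'(a_k). -/
open Matrix

namespace Submodule

/-- A span is stable under right multiplication by a matrix if the images of its generators stay
in the span. -/
theorem vecMul_mem_span {R Q : Type*} [CommRing R] [Fintype Q] {S : Set (Q → R)}
    {A : Matrix Q Q R} (h : ∀ x ∈ S, x ᵥ* A ∈ span R S) {x : Q → R} (hx : x ∈ span R S) :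
    x ᵥ* A ∈ span R S := by
  have hle : span R S ≤ (span R S).comap A.vecMulLinear := span_le.2 h
  exact hle hx

end Submodule

theorem U_eq_U' {Q σ : Type*} [Fintype Q] [DecidableEq Q] [Nonempty Q]
    [Fintype σ] [Nonempty σ]
    (M : List σ → Matrix Q Q ℝ)
    (hM0 : M [] = 1) (hMm : ∀ u v, M (u ++ v) = M u * M v)
    (hUn : ∀ w i j, M w i j = 0 ∨ M w i j = 1)
    (hComp : ∀ w, M w ≠ 0)
    (hSC : ∀ p q : Q, ∃ w, M w p q = 1)
    (α β : Q → ℝ) (hα : ∀ q, 0 < α q) (hβ : ∀ q, 0 < β q)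
    (hαA : α ᵥ* ((Fintype.card σ : ℝ)⁻¹ • ∑ a : σ, M [a]) = α)
    (hβA : ((Fintype.card σ : ℝ)⁻¹ • ∑ a : σ, M [a]) *ᵥ β = β)
    (hαβ : α ⬝ᵥ β = 1)
 :
    Submodule.span ℝ {x : Q → ℝ | ∃ w : List σ, x = α ᵥ* M w - α}
      = Submodule.span ℝ {x : Q → ℝ | ∃ w : List σ, w ≠ [] ∧
          x = α ᵥ* (w.map (fun a => M [a] - 1)).prod} := by
  apply le_antisymm
  · set U' := Submodule.span ℝ {x : Q → ℝ | ∃ w : List σ, w ≠ [] ∧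
      x = α ᵥ* (w.map (fun a => M [a] - 1)).prod}
    have letter (a : σ) : α ᵥ* M [a] - α ∈ U' :=
      Submodule.subset_span ⟨[a], by simp, by simp [Matrix.vecMul_sub]⟩
    have stable (a : σ) {x : Q → ℝ} (hx : x ∈ U') : x ᵥ* M [a] ∈ U' := by
      have hdiff : x ᵥ* (M [a] - 1) ∈ U' := by
        refine Submodule.vecMul_mem_span ?_ hx
        rintro _ ⟨w, -, rfl⟩
        exact Submodule.subset_span ⟨w ++ [a], by simp, by simp [Matrix.vecMul_vecMul]⟩
      simpa [Matrix.vecMul_sub] using U'.add_mem hdiff hx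
    refine Submodule.span_le.2 ?_
    rintro _ ⟨w, rfl⟩
    change _ ∈ U'
    induction w using List.reverseRecOn with
    | nil => simp [hM0]
    | append_singleton w a ih =>
      have h := U'.add_mem (stable a ih) (letter a)
      rwa [Matrix.sub_vecMul, sub_add_sub_cancel, Matrix.vecMul_vecMul, ← hMm] at h
  · set U := Submodule.span ℝ {x : Q → ℝ | ∃ w : List σ, x = α ᵥ* M w - α}
    have word (w : List σ) : α ᵥ* M w - α ∈ U := Submodule.subset_span ⟨w, rfl⟩
    have stable (a : σ) {x : Q → ℝ} (hx : x ∈ U) : x ᵥ* (M [a] - 1) ∈ U := by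
      have hmul : x ᵥ* M [a] ∈ U := by
        refine Submodule.vecMul_mem_span ?_ hx
        rintro _ ⟨w, rfl⟩
        have h := U.sub_mem (word (w ++ [a])) (word [a])
        rwa [sub_sub_sub_cancel_right, hMm, ← Matrix.vecMul_vecMul, ← Matrix.sub_vecMul] at h
      simpa [Matrix.vecMul_sub] using U.sub_mem hmul hx
    refine Submodule.span_le.2 ?_
    rintro _ ⟨w, hw, rfl⟩
    change _ ∈ U
    induction w using List.reverseRecOn with
    | nil => exact absurd rfl hw
    | append_singleton w a ih =>
      rcases eq_or_ne w [] with rfl | hne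
      · simpa [Matrix.vecMul_sub] using word [a]
      · simpa [Matrix.vecMul_vecMul] using stable a (ih hne)
end
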